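/- Let Γ be a Coxeter graph with vertex set S and let X, Y ⊆ S. Then the intersection of the standard parabolic subgroups A_X[Γ] and A_Y[Γ] of the Artin group A[Γ] equals the standard parabolic subgroup A_{X∩Y}[Γ]. -/

import Mathlib

/-- The alternating product `a b a b ⋯` of length `m`. -/
def altProd {G : Type*} [Monoid G] (a b : G) (m : ℕ) : G :=
  ((List.range m).map (fun i => if i % 2 = 0 then a else b)).prod

/-- The defining (braid) relations of the Artin group of a Coxeter matrix `M`.
The value `M s t = 0` encodes `m_{s,t} = ∞`. -/
def artinRels {S : Type*} (M : CoxeterMatrix S) : Set (FreeGroup S) :=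
  {r | ∃ s t : S, s ≠ t ∧ M s t ≠ 0 ∧
      r = altProd (FreeGroup.of s) (FreeGroup.of t) (M s t) *
        (altProd (FreeGroup.of t) (FreeGroup.of s) (M s t))⁻¹}

/-- The Artin group `A[Γ]` of a Coxeter matrix. -/
def ArtinGroup {S : Type*} (M : CoxeterMatrix S) : Type _ :=
  PresentedGroup (artinRels M)

instance {S : Type*} (M : CoxeterMatrix S) : Group (ArtinGroup M) := by
  unfold ArtinGroup; infer_instance

/-- The standard generator of the Artin group corresponding to `s`. -/
def ArtinGroup.gen {S : Type*} (M : CoxeterMatrix S) (s : S) : ArtinGroup M :=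
  PresentedGroup.of s

namespace CoxeterMatrix

variable {S : Type*} (M : CoxeterMatrix S)

/-- The coroot functional of `s` for the geometric representation on `S →₀ ℝ`. -/
noncomputable def coroot (s : S) : Module.Dual ℝ (S →₀ ℝ) :=
  Finsupp.linearCombination ℝ fun t => -2 * Real.cos (Real.pi / M s t)

theorem coroot_single (s t : S) :
    M.coroot s (Finsupp.single t 1) = -2 * Real.cos (Real.pi / M s t) := by
  simp [coroot]

theorem coroot_single_self (s : S) : M.coroot s (Finsupp.single s 1) = 2 := by
  simp [coroot_single]

/-- The reflection by which `s` acts in the geometric representation. -/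
noncomputable def geomReflection (s : S) : (S →₀ ℝ) ≃ₗ[ℝ] (S →₀ ℝ) :=
  Module.reflection (M.coroot_single_self s)

theorem coroot_mul_coroot (s t : S) :
    M.coroot s (Finsupp.single t 1) * M.coroot t (Finsupp.single s 1) - 2 =
      2 * Real.cos (2 * Real.pi / M s t) := by
  rw [coroot_single, coroot_single, M.symmetric t s, mul_div_assoc, Real.cos_two_mul]
  ring

theorem sin_two_pi_div_pos {m : ℕ} (hm : 3 ≤ m) : 0 < Real.sin (2 * Real.pi / m) := by
  have h3 : (3 : ℝ) ≤ m := by exact_mod_cast hm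
  have := Real.pi_pos
  apply Real.sin_pos_of_pos_of_lt_pi (by positivity)
  rw [div_lt_iff₀ (by positivity)]
  nlinarith

theorem isLiftable_geomReflection : M.IsLiftable M.geomReflection := by
  intro s t
  by_cases hst : s = t
  · subst hst
    rw [M.diagonal, pow_one]
    exact LinearEquiv.ext (Module.involutive_reflection (M.coroot_single_self s))
  have h1 := M.off_diagonal s t hst
  have key := M.coroot_mul_coroot s t
  apply LinearEquiv.ext
  intro z
  unfold geomReflection
  rw [Module.reflection_mul_reflection_pow_apply (M.coroot_single_self s)
    (M.coroot_single_self t) (M s t) z _ key.symm]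
  rcases lt_or_ge (M s t) 3 with hlt | hge
  · have : M s t = 0 ∨ M s t = 2 := by omega
    rcases this with h | h
    · simp [h]
    · have h' : M t s = 2 := by rw [M.symmetric, h]
      simp [h, h', coroot_single]
      norm_num
      module
  · have hsin := sin_two_pi_div_pos hge
    have hm0 : (M s t : ℝ) ≠ 0 := by positivity
    set θ := 2 * Real.pi / M s t with hθ
    have hmθ : (M s t : ℝ) * θ = 2 * Real.pi := by rw [hθ]; field_simp
    rcases Nat.even_or_odd' (M s t) with ⟨k, hk | hk⟩
    · have e1 : ((M s t : ℤ) - 2) / 2 = (k : ℤ) - 1 := by omega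
      have e2 : ((M s t : ℤ) - 1) / 2 = (k : ℤ) - 1 := by omega
      have hS : (Polynomial.Chebyshev.S ℝ ((k : ℤ) - 1)).eval (2 * Real.cos θ) = 0 := by
        have := Polynomial.Chebyshev.S_two_mul_real_cos θ ((k : ℤ) - 1)
        push_cast at this
        have e : ((k : ℝ) - 1 + 1) * θ = Real.pi := by
          rw [hk] at hmθ
          push_cast at hmθ
          linarith
        rw [e, Real.sin_pi] at this
        exact (mul_eq_zero.mp this).resolve_right hsin.ne'
      rw [e1, e2, hS]
      simp
    · have e1 : ((M s t : ℤ) - 2) / 2 = (k : ℤ) - 1 := by omega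
      have e2 : ((M s t : ℤ) - 1) / 2 = (k : ℤ) := by omega
      have e3 : ((M s t : ℤ) - 3) / 2 = (k : ℤ) - 1 := by omega
      have e4 : ((M s t : ℤ)) / 2 = (k : ℤ) := by omega
      have hS : (Polynomial.Chebyshev.S ℝ (k : ℤ)).eval (2 * Real.cos θ) +
          (Polynomial.Chebyshev.S ℝ ((k : ℤ) - 1)).eval (2 * Real.cos θ) = 0 := by
        have h1 := Polynomial.Chebyshev.S_two_mul_real_cos θ ((k : ℤ) - 1)
        have h2 := Polynomial.Chebyshev.S_two_mul_real_cos θ (k : ℤ)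
        push_cast at h1 h2
        have e : ((k : ℝ) + 1) * θ = 2 * Real.pi - ((k : ℝ) - 1 + 1) * θ := by
          rw [hk] at hmθ
          push_cast at hmθ
          linarith
        rw [e, Real.sin_two_pi_sub] at h2
        have : ((Polynomial.Chebyshev.S ℝ (k : ℤ)).eval (2 * Real.cos θ) +
          (Polynomial.Chebyshev.S ℝ ((k : ℤ) - 1)).eval (2 * Real.cos θ)) * Real.sin θ = 0 := by
          linarith
        exact (mul_eq_zero.mp this).resolve_right hsin.ne'
      rw [e1, e2, e3, e4, hS]
      simp

theorem geomReflection_mul_pow_ne_one {s t : S} (hst : s ≠ t) {k : ℕ} (hk : 0 < k)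
    (hkm : M s t = 0 ∨ k < M s t) : (M.geomReflection s * M.geomReflection t) ^ k ≠ 1 := by
  intro h
  have h1 := M.off_diagonal s t hst
  have key := M.coroot_mul_coroot s t
  have hx := Module.reflection_mul_reflection_pow_apply_self (M.coroot_single_self s)
    (M.coroot_single_self t) k _ key.symm
  unfold geomReflection at h
  rw [h] at hx
  have hs := DFunLike.congr_fun hx s
  have ht := DFunLike.congr_fun hx t
  simp [hst, hst.symm] at hs ht
  have hg := M.coroot_single t s
  rw [M.symmetric t s] at hg
  rw [hg] at ht
  rcases hkm with hm | hkm
  · simp [hm, Polynomial.Chebyshev.S_eval_two] at ht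
    omega
  rcases lt_or_ge (M s t) 3 with hlt | hge
  · have h2 : M s t = 2 := by omega
    have hk1 : k = 1 := by omega
    subst hk1
    simp [h2] at hs
  · have hsin := sin_two_pi_div_pos hge
    have hm3 : (3 : ℝ) ≤ M s t := by exact_mod_cast hge
    have hm0 : (0 : ℝ) < M s t := by linarith
    have hpi := Real.pi_pos
    have hcos : 0 < Real.cos (Real.pi / M s t) := by
      apply Real.cos_pos_of_mem_Ioo
      constructor
      · have : 0 < Real.pi / M s t := by positivity
        linarith
      · rw [div_lt_iff₀ hm0]
        nlinarith
    have ht' := ht.resolve_right (mul_ne_zero (by norm_num) hcos.ne')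
    rw [ht', add_zero] at hs
    have h3 := Polynomial.Chebyshev.S_two_mul_real_cos (2 * Real.pi / M s t) ((k : ℤ) - 1)
    have h4 := Polynomial.Chebyshev.S_two_mul_real_cos (2 * Real.pi / M s t) (k : ℤ)
    push_cast at h3 h4
    rw [ht', zero_mul, sub_add_cancel] at h3
    rw [← hs, one_mul, add_mul, one_mul, Real.sin_add, ← h3, zero_mul, zero_add] at h4
    have h5 : Real.cos (k * (2 * Real.pi / M s t)) = 1 := by
      have := mul_right_cancel₀ hsin.ne' (h4.symm.trans (one_mul _).symm)
      exact this
    have hk' : (k : ℝ) < M s t := by exact_mod_cast hkm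
    have hk0 : (0 : ℝ) < k := by exact_mod_cast hk
    have hpos : 0 < (k : ℝ) * (2 * Real.pi / M s t) := by positivity
    have hlt : (k : ℝ) * (2 * Real.pi / M s t) < 2 * Real.pi := by
      rw [← mul_div_assoc, div_lt_iff₀ hm0]
      nlinarith
    rw [Real.cos_eq_one_iff_of_lt_of_lt (by linarith) hlt] at h5
    linarith

end CoxeterMatrix

namespace CoxeterSystem

variable {S W : Type*} [Group W] {M : CoxeterMatrix S} (cs : CoxeterSystem M W)

/-- The product of two distinct simple reflections has order exactly `M s t`. -/
theorem simple_mul_simple_pow_ne_one {s t : S} (hst : s ≠ t) {k : ℕ} (hk : 0 < k)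
    (hkm : M s t = 0 ∨ k < M s t) : (cs.simple s * cs.simple t) ^ k ≠ 1 := by
  intro h
  apply M.geomReflection_mul_pow_ne_one hst hk hkm
  have := congrArg (cs.lift ⟨M.geomReflection, M.isLiftable_geomReflection⟩) h
  simpa using this

theorem orderOf_simple_mul_simple {s t : S} (hst : s ≠ t) :
    orderOf (cs.simple s * cs.simple t) = M s t := by
  by_cases h0 : M s t = 0
  · rw [h0, orderOf_eq_zero_iff']
    exact fun n hn => cs.simple_mul_simple_pow_ne_one hst hn (Or.inl h0)
  · rw [orderOf_eq_iff (Nat.pos_of_ne_zero h0)]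
    exact ⟨cs.simple_mul_simple_pow s t,
      fun k hk hk0 => cs.simple_mul_simple_pow_ne_one hst hk0 (Or.inr hk)⟩

theorem simple_injective : Function.Injective cs.simple := by
  intro s t h
  by_contra hst
  have := cs.orderOf_simple_mul_simple hst
  rw [h, simple_mul_simple_self, orderOf_one] at this
  exact M.off_diagonal s t hst this.symm

end CoxeterSystem

namespace CoxeterSystem

variable {S W : Type*} [Group W] {M : CoxeterMatrix S} (cs : CoxeterSystem M W)

open Classical in
/-- The action of a simple reflection on signed elements of `W`: conjugation, together with a
sign change at the simple reflection itself. -/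
noncomputable def signedConj (s : S) : W × ZMod 2 → W × ZMod 2 :=
  fun p => (cs.simple s * p.1 * cs.simple s, p.2 + if p.1 = cs.simple s then 1 else 0)

open Classical in
theorem signedConj_mul_iterate (s t : S) (k : ℕ) (ρ : W) (ε : ZMod 2) :
    (cs.signedConj s ∘ cs.signedConj t)^[k] (ρ, ε) =
      ((cs.simple s * cs.simple t) ^ k * ρ * ((cs.simple s * cs.simple t) ^ k)⁻¹,
        ε + ∑ i ∈ Finset.range (2 * k),
          if ρ = (cs.simple t * cs.simple s) ^ i * cs.simple t then 1 else 0) := by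
  induction k with
  | zero => simp
  | succ k ih =>
    rw [Function.iterate_succ_apply', ih]
    set c := cs.simple s * cs.simple t with hc
    have hc' : cs.simple t * cs.simple s = c⁻¹ := by simp [hc]
    have ht : cs.simple t * c = c⁻¹ * cs.simple t := by simp [hc, mul_assoc]
    have htk : ∀ k : ℕ, cs.simple t * c ^ k = (c⁻¹) ^ k * cs.simple t := by
      intro k
      induction k with
      | zero => simp
      | succ k ih => rw [pow_succ, ← mul_assoc, ih, mul_assoc, ht, ← mul_assoc, ← pow_succ]
    have hs : cs.simple s = c * cs.simple t := by simp [hc]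
    rw [hc', show 2 * (k + 1) = 2 * k + 1 + 1 by ring, Finset.sum_range_succ,
      Finset.sum_range_succ]
    have e1 : (c ^ k * ρ * (c ^ k)⁻¹ = cs.simple t) ↔ ρ = c⁻¹ ^ (2 * k) * cs.simple t := by
      rw [mul_inv_eq_iff_eq_mul, htk, ← eq_inv_mul_iff_mul_eq, ← inv_pow, ← mul_assoc, ← pow_add,
        two_mul]
    have e2 : (cs.simple t * (c ^ k * ρ * (c ^ k)⁻¹) * cs.simple t = cs.simple s) ↔
        ρ = c⁻¹ ^ (2 * k + 1) * cs.simple t := by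
      have : (cs.simple t * (c ^ k * ρ * (c ^ k)⁻¹) * cs.simple t = cs.simple s) ↔
        c ^ k * ρ * (c ^ k)⁻¹ = cs.simple t * c := by
        rw [hs]
        constructor
        · intro h
          have := congrArg (fun x => cs.simple t * x * cs.simple t) h
          simpa [mul_assoc] using this
        · intro h
          rw [h]
          simp
      rw [this, mul_inv_eq_iff_eq_mul, mul_assoc, ← pow_succ', htk, ← eq_inv_mul_iff_mul_eq,
        ← inv_pow, ← mul_assoc, ← pow_add]
      ring_nf
    simp only [Function.comp_apply, signedConj, e1, e2]
    refine Prod.ext ?_ ?_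
    · simp [pow_succ', hc, mul_assoc]
    · simp only []
      ring

theorem isLiftable_signedConj :
    M.IsLiftable (G := Function.End (W × ZMod 2)) (cs.signedConj) := by
  classical
  intro s t
  funext ⟨ρ, ε⟩
  have h := cs.signedConj_mul_iterate s t (M s t) ρ ε
  have hpow : ∀ (f : Function.End (W × ZMod 2)) (k : ℕ), f ^ k = f^[k] := by
    intro f k
    induction k with
    | zero => rfl
    | succ k ih => rw [pow_succ, ih]; rfl
  rw [hpow]
  refine h.trans ?_
  have hper : ∀ i : ℕ, (cs.simple t * cs.simple s) ^ (M s t + i) =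
      (cs.simple t * cs.simple s) ^ i := by
    intro i
    rw [pow_add, cs.simple_mul_simple_pow', one_mul]
  rw [two_mul, Finset.sum_range_add]
  simp only [hper, CharTwo.add_self_eq_zero, cs.simple_mul_simple_pow, one_mul, inv_one, mul_one,
    add_zero]
  rfl

/-- The action of `W` on signed elements of `W`. -/
noncomputable def signedConjHom : W →* Function.End (W × ZMod 2) :=
  cs.lift ⟨cs.signedConj, cs.isLiftable_signedConj⟩

/-- The parity of the number of times `ρ` occurs in the right inversion sequence of a word
for `w`. -/
noncomputable def invParity (w ρ : W) : ZMod 2 := (cs.signedConjHom w (ρ, 0)).2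

theorem signedConjHom_apply (w ρ : W) (ε : ZMod 2) :
    cs.signedConjHom w (ρ, ε) = (w * ρ * w⁻¹, ε + cs.invParity w ρ) := by
  have key : ∀ w : W, ∀ ρ ε, (cs.signedConjHom w (ρ, ε)) =
      (w * ρ * w⁻¹, ε + (cs.signedConjHom w (ρ, 0)).2) := by
    intro w
    induction w using cs.simple_induction_left with
    | one =>
      intro ρ ε
      rw [map_one]
      change (ρ, ε) = (1 * ρ * 1⁻¹, ε + 0)
      simp
    | mul_simple_left w i ih =>
      intro ρ ε
      have hi : cs.signedConjHom (cs.simple i) = cs.signedConj i :=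
        cs.lift_apply_simple cs.isLiftable_signedConj i
      rw [map_mul, hi]
      change cs.signedConj i (cs.signedConjHom w (ρ, ε)) =
        (_, ε + (cs.signedConj i (cs.signedConjHom w (ρ, 0))).2)
      rw [ih ρ ε, ih ρ 0]
      simp [signedConj, mul_assoc, add_assoc]
  exact key w ρ ε

theorem invParity_mul (u v ρ : W) :
    cs.invParity (u * v) ρ = cs.invParity v ρ + cs.invParity u (v * ρ * v⁻¹) := by
  have h : cs.signedConjHom (u * v) (ρ, 0) = cs.signedConjHom u (cs.signedConjHom v (ρ, 0)) := by
    rw [map_mul]; rfl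
  rw [signedConjHom_apply, signedConjHom_apply, signedConjHom_apply] at h
  simpa using congrArg Prod.snd h

open Classical in
theorem invParity_simple (s : S) (ρ : W) :
    cs.invParity (cs.simple s) ρ = if ρ = cs.simple s then 1 else 0 := by
  have hi : cs.signedConjHom (cs.simple s) = cs.signedConj s :=
    cs.lift_apply_simple cs.isLiftable_signedConj s
  rw [invParity, hi]
  simp [signedConj]

theorem invParity_one (ρ : W) : cs.invParity 1 ρ = 0 := by
  rw [invParity, map_one]
  rfl

open Classical in
theorem invParity_wordProd (ω : List S) (ρ : W) :
    cs.invParity (cs.wordProd ω) ρ = ((cs.rightInvSeq ω).count ρ : ZMod 2) := by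
  induction ω with
  | nil => simp [invParity_one]
  | cons i ω ih =>
    rw [wordProd_cons, invParity_mul, ih, invParity_simple, rightInvSeq, List.count_cons]
    push_cast
    congr 1
    have : (cs.wordProd ω * ρ * (cs.wordProd ω)⁻¹ = cs.simple i) ↔
        ((cs.wordProd ω)⁻¹ * cs.simple i * cs.wordProd ω = ρ) := by
      rw [mul_inv_eq_iff_eq_mul, ← eq_inv_mul_iff_mul_eq, eq_comm, mul_assoc]
    simp [this]

theorem exists_eraseIdx_of_invParity_ne_zero {ω : List S} {ρ : W}
    (h : cs.invParity (cs.wordProd ω) ρ ≠ 0) :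
    ∃ j < ω.length, cs.wordProd ω * ρ = cs.wordProd (ω.eraseIdx j) := by
  classical
  rw [invParity_wordProd] at h
  have hmem : ρ ∈ cs.rightInvSeq ω := by
    by_contra hn
    exact h (by rw [List.count_eq_zero_of_not_mem hn]; simp)
  obtain ⟨j, hj, rfl⟩ := List.getElem_of_mem hmem
  refine ⟨j, by simpa using hj, ?_⟩
  rw [← wordProd_mul_getD_rightInvSeq, List.getD_eq_getElem _ _ hj]

theorem length_mul_lt_of_invParity_ne_zero {w ρ : W} (h : cs.invParity w ρ ≠ 0) :
    cs.length (w * ρ) < cs.length w := by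
  obtain ⟨ω, hω, rfl⟩ := cs.exists_isReduced w
  obtain ⟨j, hj, e⟩ := cs.exists_eraseIdx_of_invParity_ne_zero h
  rw [e, hω.eq]
  refine (cs.length_wordProd_le _).trans_lt ?_
  rw [List.length_eraseIdx_of_lt hj]
  omega

/-- The standard parabolic subgroup of `W` generated by the simple reflections in `Y`. -/
def parabolic (Y : Set S) : Subgroup W := Subgroup.closure (cs.simple '' Y)

theorem simple_mem_parabolic {Y : Set S} {s : S} (hs : s ∈ Y) : cs.simple s ∈ cs.parabolic Y :=
  Subgroup.subset_closure ⟨s, hs, rfl⟩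

theorem wordProd_mem_parabolic {Y : Set S} {ω : List S} (hω : ∀ i ∈ ω, i ∈ Y) :
    cs.wordProd ω ∈ cs.parabolic Y := by
  induction ω with
  | nil => simp [one_mem]
  | cons i ω ih =>
    rw [wordProd_cons]
    exact mul_mem (cs.simple_mem_parabolic (hω i (by simp)))
      (ih fun j hj => hω j (by simp [hj]))

theorem exists_wordProd_of_mem_parabolic {Y : Set S} {d : W} (hd : d ∈ cs.parabolic Y) :
    ∃ ω : List S, (∀ i ∈ ω, i ∈ Y) ∧ cs.wordProd ω = d := by
  induction hd using Subgroup.closure_induction with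
  | mem x hx =>
    obtain ⟨s, hs, rfl⟩ := hx
    exact ⟨[s], by simpa using hs, by simp⟩
  | one => exact ⟨[], by simp, by simp⟩
  | mul x y _ _ hx hy =>
    obtain ⟨ω, h1, rfl⟩ := hx
    obtain ⟨ω', h1', rfl⟩ := hy
    refine ⟨ω ++ ω', ?_, wordProd_append ..⟩
    intro i hi
    rcases List.mem_append.mp hi with h | h
    exacts [h1 i h, h1' i h]
  | inv x _ hx =>
    obtain ⟨ω, h1, rfl⟩ := hx
    exact ⟨ω.reverse, by simpa using h1, by simp⟩

/-- A nontrivial element of a standard parabolic subgroup has a right descent in the defining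
set of generators. -/
theorem exists_invParity_simple_ne_zero {Y : Set S} {d : W} (hd : d ∈ cs.parabolic Y)
    (h1 : d ≠ 1) : ∃ y ∈ Y, cs.invParity d (cs.simple y) ≠ 0 := by
  classical
  have hex : ∃ n, ∃ ω : List S, ω.length = n ∧ (∀ i ∈ ω, i ∈ Y) ∧ cs.wordProd ω = d := by
    obtain ⟨ω, h⟩ := cs.exists_wordProd_of_mem_parabolic hd
    exact ⟨_, ω, rfl, h⟩
  obtain ⟨ω, hlen, hω, hprod⟩ := Nat.find_spec hex
  rcases List.eq_nil_or_concat' ω with rfl | ⟨ω', y, rfl⟩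
  · simp at hprod
    exact absurd hprod.symm h1
  have hy : y ∈ Y := hω y (by simp)
  have hω' : ∀ i ∈ ω', i ∈ Y := fun i hi => hω i (by simp [hi])
  refine ⟨y, hy, fun h0 => ?_⟩
  have hprod' : cs.wordProd ω' * cs.simple y = d := by
    rw [← hprod, wordProd_append, wordProd_singleton]
  rw [← hprod', invParity_mul, invParity_simple, if_pos rfl] at h0
  simp only [simple_mul_simple_self, one_mul, inv_simple] at h0
  have hne : cs.invParity (cs.wordProd ω') (cs.simple y) ≠ 0 := by
    intro h
    rw [h] at h0
    simp at h0
  obtain ⟨j, hj, e⟩ := cs.exists_eraseIdx_of_invParity_ne_zero hne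
  have hmin := Nat.find_min' hex ⟨ω'.eraseIdx j, rfl,
    fun i hi => hω' i ((List.eraseIdx_sublist _ _).subset hi), by rw [← e, hprod']⟩
  rw [← hlen, List.length_eraseIdx_of_lt hj] at hmin
  simp at hmin
  omega

theorem simple_ne_one (s : S) : cs.simple s ≠ 1 := fun h => by
  have := cs.length_simple s
  rw [h, length_one] at this
  omega

theorem mem_of_simple_mem_parabolic {Y : Set S} {s : S} (h : cs.simple s ∈ cs.parabolic Y) :
    s ∈ Y := by
  classical
  obtain ⟨y, hy, hne⟩ := cs.exists_invParity_simple_ne_zero h (cs.simple_ne_one s)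
  rw [invParity_simple] at hne
  have : cs.simple y = cs.simple s := by
    by_contra h'
    simp [h'] at hne
  exact cs.simple_injective this ▸ hy

end CoxeterSystem

namespace CoxeterSystem

variable {S W : Type*} [Group W] {M : CoxeterMatrix S} (cs : CoxeterSystem M W)

theorem exists_eq_mul_invParity_eq_zero (Y : Set S) (w : W) :
    ∃ d ∈ cs.parabolic Y, ∃ u, w = d * u ∧
      ∀ ρ, u * ρ * u⁻¹ ∈ cs.parabolic Y → cs.invParity u ρ = 0 := by
  classical
  have hex : ∃ n, ∃ d ∈ cs.parabolic Y, cs.length (d * w) = n := ⟨_, 1, one_mem _, rfl⟩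
  obtain ⟨d, hd, hlen⟩ := Nat.find_spec hex
  refine ⟨d⁻¹, inv_mem hd, d * w, by simp, fun ρ hρ => ?_⟩
  by_contra hne
  have hlt := cs.length_mul_lt_of_invParity_ne_zero hne
  have hmin := Nat.find_min' hex ⟨d * w * ρ * (d * w)⁻¹ * d, mul_mem hρ hd, rfl⟩
  have e : d * w * ρ * (d * w)⁻¹ * d * w = d * w * ρ := by group
  rw [e, ← hlen] at hmin
  omega

theorem exists_conj_eq_simple {Y : Set S} {u : W}
    (hu : ∀ ρ, u * ρ * u⁻¹ ∈ cs.parabolic Y → cs.invParity u ρ = 0) {x : S}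
    (hx : u * cs.simple x * u⁻¹ ∈ cs.parabolic Y) :
    ∃ z ∈ Y, u * cs.simple x * u⁻¹ = cs.simple z := by
  classical
  obtain ⟨z, hz, hne⟩ := cs.exists_invParity_simple_ne_zero hx
    (fun h => cs.simple_ne_one x (by simpa using h))
  refine ⟨z, hz, ?_⟩
  have hzY := cs.simple_mem_parabolic hz
  have h1 := cs.invParity_mul (u * cs.simple x * u⁻¹) u (u⁻¹ * cs.simple z * u)
  have h2 := cs.invParity_mul u (cs.simple x) (u⁻¹ * cs.simple z * u)
  rw [hu _ (by simpa [mul_assoc] using hzY), zero_add] at h1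
  rw [hu _ (by simpa [mul_assoc] using mul_mem (mul_mem hx hzY) (inv_mem hx)), add_zero,
    invParity_simple] at h2
  rw [inv_mul_cancel_right, h2] at h1
  have e : u * (u⁻¹ * cs.simple z * u) * u⁻¹ = cs.simple z := by group
  rw [e] at h1
  have h3 : u⁻¹ * cs.simple z * u = cs.simple x := by
    by_contra hn
    rw [if_neg hn] at h1
    exact hne h1.symm
  rw [← h3, e]

/-- `w` is the shortest element of its coset `w W_X`. -/
def IsMinimal (X : Set S) (w : W) : Prop := ∀ x ∈ X, cs.invParity w (cs.simple x) = 0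

theorem IsMinimal.conj_eq_simple {X : Set S} {w : W} (hw : cs.IsMinimal X w) {s t x y : S}
    (hx : x ∈ X) (hy : y ∈ X) (hxy : x ≠ y)
    (hxD : w * cs.simple x * w⁻¹ ∈ cs.parabolic {s, t})
    (hyD : w * cs.simple y * w⁻¹ ∈ cs.parabolic {s, t}) :
    (w * cs.simple x * w⁻¹ = cs.simple s ∧ w * cs.simple y * w⁻¹ = cs.simple t) ∨
      (w * cs.simple y * w⁻¹ = cs.simple s ∧ w * cs.simple x * w⁻¹ = cs.simple t) := by
  obtain ⟨d, hd, u, rfl, hu⟩ := cs.exists_eq_mul_invParity_eq_zero {s, t} w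
  have hconj : ∀ v : W, d * u * v * (d * u)⁻¹ ∈ cs.parabolic {s, t} →
      u * v * u⁻¹ ∈ cs.parabolic {s, t} := fun v hv => by
    have := mul_mem (mul_mem (inv_mem hd) hv) hd
    simpa [mul_assoc] using this
  obtain ⟨z, hz, hzx⟩ := cs.exists_conj_eq_simple hu (hconj _ hxD)
  obtain ⟨z', hz', hzy⟩ := cs.exists_conj_eq_simple hu (hconj _ hyD)
  have hzz : z ≠ z' := by
    rintro rfl
    apply hxy
    apply cs.simple_injective
    have := hzx.trans hzy.symm
    simpa using this
  have hd0 : ∀ v ∈ X, u * cs.simple v * u⁻¹ ∈ cs.parabolic {s, t} →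
      cs.invParity d (u * cs.simple v * u⁻¹) = 0 := by
    intro v hv hvD
    have := hw v hv
    rwa [invParity_mul, hu _ hvD, zero_add] at this
  have hdz := hd0 x hx (hconj _ hxD)
  have hdz' := hd0 y hy (hconj _ hyD)
  rw [hzx] at hdz
  rw [hzy] at hdz'
  have hd1 : d = 1 := by
    by_contra hd1
    obtain ⟨v, hv, hne⟩ := cs.exists_invParity_simple_ne_zero hd hd1
    rcases hz with rfl | rfl <;> rcases hz' with rfl | rfl <;> rcases hv with rfl | rfl <;>
      first | exact hzz rfl | exact hne hdz | exact hne hdz'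
  subst hd1
  rw [one_mul, hzx, hzy]
  rcases hz with rfl | rfl <;> rcases hz' with rfl | rfl
  · exact absurd rfl hzz
  · exact Or.inl ⟨rfl, rfl⟩
  · exact Or.inr ⟨rfl, rfl⟩
  · exact absurd rfl hzz

theorem rightInvSeq_alternatingWord_perm (s t : S) (m : ℕ) :
    (cs.rightInvSeq (alternatingWord s t m)).Perm
      ((List.range m).map fun k => (cs.simple t * cs.simple s) ^ k * cs.simple t) := by
  induction m generalizing s t with
  | zero => simp [alternatingWord]
  | succ m ih =>
    rw [alternatingWord_succ, rightInvSeq_concat, List.range_succ_eq_map, List.map_cons,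
      List.concat_eq_append, List.map_map]
    refine List.perm_append_singleton _ _ |>.trans ?_
    rw [pow_zero, one_mul]
    refine List.Perm.cons _ ?_
    refine ((ih t s).map _).trans ?_
    rw [List.map_map]
    refine List.Perm.of_eq (List.map_congr_left fun k _ => ?_)
    simp only [Function.comp_apply, MulAut.conj_apply, inv_simple, Nat.succ_eq_add_one]
    have hsc : SemiconjBy (cs.simple t) (cs.simple s * cs.simple t)
      (cs.simple t * cs.simple s) := (mul_assoc _ _ _).symm
    rw [← mul_assoc, (hsc.pow_right k).eq, pow_succ]
    simp [mul_assoc]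

theorem rightInvSeq_braidWord_perm (s t : S) :
    (cs.rightInvSeq (alternatingWord s t (M s t))).Perm
      (cs.rightInvSeq (alternatingWord t s (M s t))) := by
  refine (cs.rightInvSeq_alternatingWord_perm s t _).trans
    (List.Perm.trans ?_ (cs.rightInvSeq_alternatingWord_perm t s _).symm)
  refine List.Perm.trans (List.Perm.of_eq ?_) (List.reverse_perm _)
  refine List.ext_getElem (by simp) fun k hk _ => ?_
  have hk' : k < M s t := by simpa using hk
  simp only [List.getElem_map, List.getElem_range, List.getElem_reverse, List.length_map,
    List.length_range]
  have e : M s t = (M s t - 1 - k) + 1 + k := by omega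
  have h := cs.simple_mul_simple_pow s t
  have hinv : cs.simple t * cs.simple s = (cs.simple s * cs.simple t)⁻¹ := by simp
  rw [e, pow_add, mul_eq_one_iff_eq_inv, pow_succ, ← inv_pow, ← hinv] at h
  rw [← h]
  simp [mul_assoc]

theorem wordProd_braidWord_comm (s t : S) :
    cs.wordProd (alternatingWord s t (M s t)) = cs.wordProd (alternatingWord t s (M s t)) := by
  have := cs.wordProd_braidWord_eq s t
  rwa [braidWord, braidWord, M.symmetric t s] at this

theorem mem_of_mem_alternatingWord {s t i : S} {m : ℕ} (h : i ∈ alternatingWord s t m) :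
    i ∈ ({s, t} : Set S) := by
  induction m generalizing s t with
  | zero => simp [alternatingWord] at h
  | succ m ih =>
    rw [alternatingWord_succ, List.concat_eq_append, List.mem_append] at h
    rcases h with h | h
    · rw [Set.pair_comm]
      exact ih h
    · simp at h
      simp [h]

variable {G : Type*} [Group G] (X : Set S) (g : S → G)

open Classical in
/-- The value of `g` at `x` if `ρ` is the simple reflection of some `x ∈ X`, and `1` otherwise. -/
noncomputable def label (ρ : W) : G :=
  if h : ∃ x ∈ X, cs.simple x = ρ then g h.choose else 1

theorem label_simple {x : S} (hx : x ∈ X) : cs.label X g (cs.simple x) = g x := by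
  have h : ∃ y ∈ X, cs.simple y = cs.simple x := ⟨x, hx, rfl⟩
  rw [label, dif_pos h, cs.simple_injective h.choose_spec.2]

theorem label_eq_one {ρ : W} (h : ρ ∉ cs.simple '' X) : cs.label X g ρ = 1 :=
  dif_neg h

open Classical in
/-- The action of a simple reflection `s` on shortest representatives of cosets `w W_X`. -/
noncomputable def move (s : S) (w : W) : W :=
  if w⁻¹ * cs.simple s * w ∈ cs.simple '' X then w else cs.simple s * w

theorem move_of_mem {s : S} {w : W} (h : w⁻¹ * cs.simple s * w ∈ cs.simple '' X) :
    cs.move X s w = w := if_pos h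

theorem move_of_notMem {s : S} {w : W} (h : w⁻¹ * cs.simple s * w ∉ cs.simple '' X) :
    cs.move X s w = cs.simple s * w := if_neg h

theorem conj_move (s : S) (w : W) :
    (cs.move X s w)⁻¹ * cs.simple s * cs.move X s w = w⁻¹ * cs.simple s * w := by
  by_cases h : w⁻¹ * cs.simple s * w ∈ cs.simple '' X
  · rw [cs.move_of_mem X h]
  · rw [cs.move_of_notMem X h]
    simp [mul_assoc]

theorem move_move (s : S) (w : W) : cs.move X s (cs.move X s w) = w := by
  by_cases h : w⁻¹ * cs.simple s * w ∈ cs.simple '' X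
  · rw [cs.move_of_mem X h, cs.move_of_mem X h]
  · have h' := h
    rw [← cs.conj_move X] at h'
    rw [cs.move_of_notMem X h', cs.move_of_notMem X h]
    simp

theorem IsMinimal.move {X : Set S} {w : W} (hw : cs.IsMinimal X w) (s : S) :
    cs.IsMinimal X (cs.move X s w) := by
  by_cases h : w⁻¹ * cs.simple s * w ∈ cs.simple '' X
  · rwa [cs.move_of_mem X h]
  · rw [cs.move_of_notMem X h]
    intro x hx
    rw [invParity_mul, hw x hx, invParity_simple, if_neg, add_zero]
    intro h'
    exact h ⟨x, hx, by rw [← h']; group⟩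

/-- The permutation by which a generator `s` acts on pairs of a shortest coset representative and
an element of `G`. -/
noncomputable def stepEquiv (s : S) : Equiv.Perm {p : W × G // cs.IsMinimal X p.1} where
  toFun p := ⟨(cs.move X s p.1.1, cs.label X g (p.1.1⁻¹ * cs.simple s * p.1.1) * p.1.2),
    p.2.move cs s⟩
  invFun p := ⟨(cs.move X s p.1.1, (cs.label X g (p.1.1⁻¹ * cs.simple s * p.1.1))⁻¹ * p.1.2),
    p.2.move cs s⟩
  left_inv p := by
    apply Subtype.ext
    simp [conj_move, move_move]
  right_inv p := by
    apply Subtype.ext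
    simp [conj_move, move_move]

variable {X}

theorem stepEquiv_of_eq {s x : S} {p : {p : W × G // cs.IsMinimal X p.1}} (hx : x ∈ X)
    (h : p.1.1⁻¹ * cs.simple s * p.1.1 = cs.simple x) :
    (cs.stepEquiv X g s p).1 = (p.1.1, g x * p.1.2) := by
  simp only [stepEquiv, Equiv.coe_fn_mk]
  rw [cs.move_of_mem X (h ▸ ⟨x, hx, rfl⟩), h, cs.label_simple X g hx]

theorem stepEquiv_of_notMem {s : S} {p : {p : W × G // cs.IsMinimal X p.1}}
    (h : p.1.1⁻¹ * cs.simple s * p.1.1 ∉ cs.simple '' X) :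
    (cs.stepEquiv X g s p).1 = (cs.simple s * p.1.1, p.1.2) := by
  simp only [stepEquiv, Equiv.coe_fn_mk]
  rw [cs.move_of_notMem X h, cs.label_eq_one X g h, one_mul]

theorem stepEquiv_word_of_forall_notMem {Y : Set S} {p : {p : W × G // cs.IsMinimal X p.1}}
    (h : ∀ x ∈ X, p.1.1 * cs.simple x * p.1.1⁻¹ ∉ cs.parabolic Y)
    {ω : List S} (hω : ∀ i ∈ ω, i ∈ Y) :
    ((ω.map (cs.stepEquiv X g)).prod p).1 = (cs.wordProd ω * p.1.1, p.1.2) := by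
  induction ω with
  | nil => simp
  | cons i ω ih =>
    have hω' : ∀ j ∈ ω, j ∈ Y := fun j hj => hω j (by simp [hj])
    have ih := ih hω'
    rw [List.map_cons, List.prod_cons, Equiv.Perm.mul_apply, stepEquiv_of_notMem, ih,
      wordProd_cons, mul_assoc]
    rw [ih]
    rintro ⟨x, hx, e⟩
    apply h x hx
    have hπ := cs.wordProd_mem_parabolic hω'
    have hi := cs.simple_mem_parabolic (hω i (by simp))
    have e' : p.1.1 * cs.simple x * p.1.1⁻¹ =
        (cs.wordProd ω)⁻¹ * cs.simple i * cs.wordProd ω := by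
      rw [e]; group
    rw [e']
    exact mul_mem (mul_mem (inv_mem hπ) hi) hπ

open Classical in
theorem stepEquiv_word_of_unique {Y : Set S} {p : {p : W × G // cs.IsMinimal X p.1}} {x : S}
    (hx : x ∈ X) (hxY : p.1.1 * cs.simple x * p.1.1⁻¹ ∈ cs.parabolic Y)
    (h : ∀ y ∈ X, p.1.1 * cs.simple y * p.1.1⁻¹ ∈ cs.parabolic Y → y = x)
    {ω : List S} (hω : ∀ i ∈ ω, i ∈ Y) :
    ((ω.map (cs.stepEquiv X g)).prod p).1 =
      (cs.wordProd ω * p.1.1 *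
        cs.simple x ^ (cs.rightInvSeq ω).count (p.1.1 * cs.simple x * p.1.1⁻¹),
        g x ^ (cs.rightInvSeq ω).count (p.1.1 * cs.simple x * p.1.1⁻¹) * p.1.2) := by
  induction ω with
  | nil => simp
  | cons i ω ih =>
    have hω' : ∀ j ∈ ω, j ∈ Y := fun j hj => hω j (by simp [hj])
    have ih := ih hω'
    have hπ := cs.wordProd_mem_parabolic hω'
    have hi := cs.simple_mem_parabolic (hω i (by simp))
    rw [List.map_cons, List.prod_cons, Equiv.Perm.mul_apply]
    generalize (ω.map (cs.stepEquiv X g)).prod p = q at ih ⊢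
    rw [rightInvSeq, List.count_cons]
    set n := (cs.rightInvSeq ω).count (p.1.1 * cs.simple x * p.1.1⁻¹)
    set w := p.1.1
    by_cases hloop : (cs.wordProd ω)⁻¹ * cs.simple i * cs.wordProd ω = w * cs.simple x * w⁻¹
    · have hq : q.1.1⁻¹ * cs.simple i * q.1.1 = cs.simple x := by
        have e : q.1.1⁻¹ * cs.simple i * q.1.1 = (cs.simple x ^ n)⁻¹ * w⁻¹ *
            ((cs.wordProd ω)⁻¹ * cs.simple i * cs.wordProd ω) * w * cs.simple x ^ n := by
          rw [ih]; group
        rw [e, hloop]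
        group
      rw [cs.stepEquiv_of_eq g hx hq, ih]
      have e : cs.simple i * cs.wordProd ω = cs.wordProd ω * (w * cs.simple x * w⁻¹) := by
        rw [← hloop]; group
      rw [wordProd_cons, e, if_pos (by simp [hloop])]
      refine Prod.ext ?_ ?_
      · simp [mul_assoc, pow_succ']
      · simp [mul_assoc, pow_succ']
    · have hq : q.1.1⁻¹ * cs.simple i * q.1.1 ∉ cs.simple '' X := by
        rintro ⟨y, hy, e⟩
        have e' : w * cs.simple y * w⁻¹ = (w * cs.simple x * w⁻¹) ^ (-(n : ℤ)) *
            ((cs.wordProd ω)⁻¹ * cs.simple i * cs.wordProd ω) *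
              (w * cs.simple x * w⁻¹) ^ (n : ℤ) := by
          rw [e, ih, conj_zpow, conj_zpow]
          group
        have hyx : y = x := by
          apply h y hy
          rw [e']
          exact mul_mem (mul_mem (zpow_mem hxY _) (mul_mem (mul_mem (inv_mem hπ) hi) hπ))
            (zpow_mem hxY _)
        subst hyx
        apply hloop
        have e'' : (cs.wordProd ω)⁻¹ * cs.simple i * cs.wordProd ω =
            (w * cs.simple y * w⁻¹) ^ (n : ℤ) * (w * cs.simple y * w⁻¹) *
              (w * cs.simple y * w⁻¹) ^ (-(n : ℤ)) := by
          nth_rw 2 [e']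
          group
        rw [e'']
        generalize w * cs.simple y * w⁻¹ = c
        group
      rw [cs.stepEquiv_of_notMem g hq, ih, if_neg (by simpa using hloop), wordProd_cons]
      simp [mul_assoc]

theorem stepEquiv_word_of_fixed {Y : Set S} {p : {p : W × G // cs.IsMinimal X p.1}} (f : S → S)
    (hf : ∀ i ∈ Y, f i ∈ X ∧ p.1.1⁻¹ * cs.simple i * p.1.1 = cs.simple (f i))
    {ω : List S} (hω : ∀ i ∈ ω, i ∈ Y) :
    ((ω.map (cs.stepEquiv X g)).prod p).1 = (p.1.1, (ω.map (g ∘ f)).prod * p.1.2) := by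
  induction ω with
  | nil => simp
  | cons i ω ih =>
    have ih := ih fun j hj => hω j (by simp [hj])
    obtain ⟨h1, h2⟩ := hf i (hω i (by simp))
    rw [List.map_cons, List.prod_cons, Equiv.Perm.mul_apply,
      cs.stepEquiv_of_eq g h1 (by rw [ih]; exact h2), ih]
    simp [mul_assoc]

end CoxeterSystem

section altProd

variable {H : Type*} [Monoid H]

theorem altProd_succ (a b : H) (m : ℕ) : altProd a b (m + 1) = a * altProd b a m := by
  unfold altProd
  rw [List.range_succ_eq_map, List.map_cons, List.prod_cons, List.map_map]
  congr 2
  refine List.map_congr_left fun i _ => ?_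
  rcases Nat.mod_two_eq_zero_or_one i with h | h <;> simp [Nat.add_mod, h]

theorem map_altProd {K : Type*} [Monoid K] (f : H →* K) (a b : H) (m : ℕ) :
    f (altProd a b m) = altProd (f a) (f b) m := by
  induction m generalizing a b with
  | zero => simp [altProd]
  | succ m ih => rw [altProd_succ, altProd_succ, map_mul, ih]

theorem altProd_eq_prod_alternatingWord {S : Type*} (h : S → H) (s t : S) (m : ℕ) :
    altProd (h s) (h t) m =
      if Even m then ((CoxeterSystem.alternatingWord s t m).map h).prod
      else ((CoxeterSystem.alternatingWord t s m).map h).prod := by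
  induction m generalizing s t with
  | zero => simp [altProd, CoxeterSystem.alternatingWord]
  | succ m ih =>
    rw [altProd_succ, ih]
    by_cases hm : Even m
    · simp [hm, Nat.even_add_one, CoxeterSystem.alternatingWord_succ']
    · simp [hm, Nat.even_add_one, CoxeterSystem.alternatingWord_succ']

theorem altProd_comm_iff {S : Type*} (h : S → H) (s t : S) (m : ℕ) :
    altProd (h s) (h t) m = altProd (h t) (h s) m ↔
      ((CoxeterSystem.alternatingWord s t m).map h).prod =
        ((CoxeterSystem.alternatingWord t s m).map h).prod := by
  rw [altProd_eq_prod_alternatingWord, altProd_eq_prod_alternatingWord]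
  split_ifs
  · rfl
  · exact eq_comm

end altProd

namespace CoxeterSystem

variable {S W : Type*} [Group W] {M : CoxeterMatrix S} (cs : CoxeterSystem M W)

theorem stepEquiv_braid {G : Type*} [Group G] (X : Set S) (g : S → G)
    (hg : ∀ s t, s ≠ t → M s t ≠ 0 → altProd (g s) (g t) (M s t) = altProd (g t) (g s) (M s t))
    (s t : S) (hst : s ≠ t) (hM : M s t ≠ 0) :
    altProd (cs.stepEquiv X g s) (cs.stepEquiv X g t) (M s t) =
      altProd (cs.stepEquiv X g t) (cs.stepEquiv X g s) (M s t) := by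
  classical
  rw [altProd_comm_iff]
  ext1 p
  apply Subtype.ext
  have hω : ∀ i ∈ alternatingWord s t (M s t), i ∈ ({s, t} : Set S) :=
    fun i => mem_of_mem_alternatingWord
  have hω' : ∀ i ∈ alternatingWord t s (M s t), i ∈ ({s, t} : Set S) := fun i hi => by
    rw [Set.pair_comm]
    exact mem_of_mem_alternatingWord hi
  by_cases h0 : ∀ x ∈ X, p.1.1 * cs.simple x * p.1.1⁻¹ ∉ cs.parabolic {s, t}
  · rw [cs.stepEquiv_word_of_forall_notMem g h0 hω, cs.stepEquiv_word_of_forall_notMem g h0 hω',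
      wordProd_braidWord_comm]
  push Not at h0
  obtain ⟨x, hx, hxD⟩ := h0
  by_cases h1 : ∀ y ∈ X, p.1.1 * cs.simple y * p.1.1⁻¹ ∈ cs.parabolic {s, t} → y = x
  · rw [cs.stepEquiv_word_of_unique g hx hxD h1 hω, cs.stepEquiv_word_of_unique g hx hxD h1 hω',
      wordProd_braidWord_comm, (cs.rightInvSeq_braidWord_perm s t).count_eq]
  push Not at h1
  obtain ⟨y, hy, hyD, hyx⟩ := h1
  obtain ⟨x', hx', y', hy', hs, ht⟩ : ∃ x' ∈ X, ∃ y' ∈ X,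
      p.1.1 * cs.simple x' * p.1.1⁻¹ = cs.simple s ∧
        p.1.1 * cs.simple y' * p.1.1⁻¹ = cs.simple t := by
    rcases p.2.conj_eq_simple cs hx hy hyx.symm hxD hyD with h | h
    exacts [⟨x, hx, y, hy, h⟩, ⟨y, hy, x, hx, h⟩]
  have hne : x' ≠ y' := by
    rintro rfl
    exact hst (cs.simple_injective (hs.symm.trans ht))
  have hMxy : M x' y' = M s t := by
    rw [← cs.orderOf_simple_mul_simple hne, ← cs.orderOf_simple_mul_simple hst, ← hs, ← ht,
      conj_mul, ← MulAut.conj_apply]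
    exact (MulEquiv.orderOf_eq _ _).symm
  have hf : ∀ i ∈ ({s, t} : Set S), (if i = s then x' else y') ∈ X ∧
      p.1.1⁻¹ * cs.simple i * p.1.1 = cs.simple (if i = s then x' else y') := by
    rintro i (rfl | rfl)
    · rw [if_pos rfl]
      exact ⟨hx', by rw [← hs]; group⟩
    · rw [if_neg hst.symm]
      exact ⟨hy', by rw [← ht]; group⟩
  rw [cs.stepEquiv_word_of_fixed g _ hf hω, cs.stepEquiv_word_of_fixed g _ hf hω']
  have hgxy := hg x' y' hne (hMxy ▸ hM)
  rw [hMxy] at hgxy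
  have := (altProd_comm_iff (g ∘ fun i => if i = s then x' else y') s t (M s t)).mp
    (by simpa [hst.symm] using hgxy)
  rw [this]

end CoxeterSystem

namespace ArtinGroup

variable {S : Type*} (M : CoxeterMatrix S)

theorem gen_braid {s t : S} (hst : s ≠ t) (hM : M s t ≠ 0) :
    altProd (gen M s) (gen M t) (M s t) = altProd (gen M t) (gen M s) (M s t) := by
  have h : PresentedGroup.mk (artinRels M) (altProd (FreeGroup.of s) (FreeGroup.of t) (M s t)) =
      PresentedGroup.mk (artinRels M) (altProd (FreeGroup.of t) (FreeGroup.of s) (M s t)) := by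
    rw [← mul_inv_eq_one, ← map_inv, ← map_mul]
    exact PresentedGroup.one_of_mem ⟨s, t, hst, hM, rfl⟩
  rw [map_altProd, map_altProd] at h
  exact h

/-- The action of the Artin group on pairs of a shortest representative of a coset of `W_X` and
an element of the Artin group. -/
noncomputable def cosetAction (X : Set S) : ArtinGroup M →*
    Equiv.Perm {p : M.Group × ArtinGroup M // M.toCoxeterSystem.IsMinimal X p.1} :=
  PresentedGroup.toGroup (rels := artinRels M) (f := M.toCoxeterSystem.stepEquiv X (gen M)) (by
    rintro r ⟨s, t, hst, hM, rfl⟩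
    rw [map_mul, map_inv, mul_inv_eq_one, map_altProd, map_altProd]
    simp only [FreeGroup.lift_apply_of]
    exact M.toCoxeterSystem.stepEquiv_braid X (gen M) (fun s t => gen_braid M) s t hst hM)

theorem cosetAction_gen (X : Set S) (s : S) :
    cosetAction M X (gen M s) = M.toCoxeterSystem.stepEquiv X (gen M) s :=
  PresentedGroup.toGroup.of _

theorem cosetAction_of_mem {X : Set S} {a : ArtinGroup M}
    (ha : a ∈ Subgroup.closure (gen M '' X))
    (p : {p : M.Group × ArtinGroup M // M.toCoxeterSystem.IsMinimal X p.1}) (hp : p.1.1 = 1) :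
    (cosetAction M X a p).1 = (1, a * p.1.2) := by
  induction ha using Subgroup.closure_induction generalizing p with
  | mem a ha =>
    obtain ⟨x, hx, rfl⟩ := ha
    rw [cosetAction_gen, CoxeterSystem.stepEquiv_of_eq _ _ hx (by simp [hp]), hp]
  | one => simp [← hp]
  | mul a b _ _ iha ihb =>
    rw [map_mul, Equiv.Perm.mul_apply, iha _ (by rw [ihb p hp]), ihb p hp, mul_assoc]
  | inv a _ iha =>
    have hmin : M.toCoxeterSystem.IsMinimal X 1 := hp ▸ p.2
    have h := iha ⟨(1, a⁻¹ * p.1.2), hmin⟩ rfl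
    have hq : cosetAction M X a ⟨(1, a⁻¹ * p.1.2), hmin⟩ = p := by
      apply Subtype.ext
      rw [h]
      simp [← hp]
    rw [map_inv, Equiv.Perm.inv_eq_iff_eq.mpr hq.symm]

theorem cosetAction_parabolic {X Y : Set S} {a : ArtinGroup M}
    (ha : a ∈ Subgroup.closure (gen M '' Y))
    (p : {p : M.Group × ArtinGroup M // M.toCoxeterSystem.IsMinimal X p.1}) :
    ((cosetAction M X a p).1.1 ∈ M.toCoxeterSystem.parabolic Y ↔
        p.1.1 ∈ M.toCoxeterSystem.parabolic Y) ∧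
      (p.1.1 ∈ M.toCoxeterSystem.parabolic Y →
        ∃ c ∈ Subgroup.closure (gen M '' (X ∩ Y)), (cosetAction M X a p).1.2 = c * p.1.2) := by
  induction ha using Subgroup.closure_induction generalizing p with
  | mem a ha =>
    obtain ⟨y, hy, rfl⟩ := ha
    have hyW := M.toCoxeterSystem.simple_mem_parabolic hy
    rw [cosetAction_gen]
    by_cases h : p.1.1⁻¹ * M.toCoxeterSystem.simple y * p.1.1 ∈ M.toCoxeterSystem.simple '' X
    · obtain ⟨x, hx, e⟩ := h
      rw [CoxeterSystem.stepEquiv_of_eq _ _ hx e.symm]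
      refine ⟨Iff.rfl, fun hp => ⟨gen M x, Subgroup.subset_closure ⟨x, ⟨hx, ?_⟩, rfl⟩, rfl⟩⟩
      apply M.toCoxeterSystem.mem_of_simple_mem_parabolic
      rw [e]
      exact mul_mem (mul_mem (inv_mem hp) hyW) hp
    · rw [CoxeterSystem.stepEquiv_of_notMem _ _ h]
      exact ⟨Subgroup.mul_mem_cancel_left _ hyW, fun _ => ⟨1, one_mem _, (one_mul _).symm⟩⟩
  | one => exact ⟨by simp, fun _ => ⟨1, one_mem _, by simp⟩⟩
  | mul a b _ _ iha ihb =>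
    rw [map_mul, Equiv.Perm.mul_apply]
    refine ⟨(iha _).1.trans (ihb p).1, fun hp => ?_⟩
    obtain ⟨c, hc, e⟩ := (iha (cosetAction M X b p)).2 ((ihb p).1.mpr hp)
    obtain ⟨c', hc', e'⟩ := (ihb p).2 hp
    exact ⟨c * c', mul_mem hc hc', by rw [e, e', mul_assoc]⟩
  | inv a _ iha =>
    have hq := iha ((cosetAction M X a)⁻¹ p)
    rw [← Equiv.Perm.mul_apply, mul_inv_cancel, Equiv.Perm.one_apply] at hq
    rw [map_inv]
    refine ⟨hq.1.symm, fun hp => ?_⟩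
    obtain ⟨c, hc, e⟩ := hq.2 (hq.1.mp hp)
    exact ⟨c⁻¹, inv_mem hc, by rw [e, inv_mul_cancel_left]⟩

end ArtinGroup

/-- **Proposition 2.12.** `A_X[Γ] ∩ A_Y[Γ] = A_{X∩Y}[Γ]`. -/
theorem artin_parabolic_inter {S : Type*} [Fintype S] [DecidableEq S]
    (M : CoxeterMatrix S) (X Y : Set S) :
    Subgroup.closure (ArtinGroup.gen M '' X) ⊓ Subgroup.closure (ArtinGroup.gen M '' Y) =
      Subgroup.closure (ArtinGroup.gen M '' (X ∩ Y)) := by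
  apply le_antisymm
  · rintro a ⟨haX, haY⟩
    have hmin : M.toCoxeterSystem.IsMinimal X 1 := fun x _ => CoxeterSystem.invParity_one _ _
    have h1 := ArtinGroup.cosetAction_of_mem M haX ⟨(1, 1), hmin⟩ rfl
    obtain ⟨c, hc, e⟩ :=
      (ArtinGroup.cosetAction_parabolic M (X := X) haY ⟨(1, 1), hmin⟩).2 (one_mem _)
    rw [h1] at e
    have hac : a = c := by simpa using e
    exact hac ▸ hc
  · exact le_inf (Subgroup.closure_mono (Set.image_mono Set.inter_subset_left))
      (Subgroup.closure_mono (Set.image_mono Set.inter_subset_right))
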